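/- arXiv:1711.07168 — 5 statements merged into one kernel-verified Lean document; each statement's English description precedes it below -/
import Mathlib

section
/- Let p and q be positive continuously differentiable probability densities on ℝ^d, fix a coordinate i ∈ {1,…,d}, and let k : ℝ^d × ℝ^d → ℝ be continuously differentiable in the i-th coordinate of each argument with continuous mixed partial ∂_{x_i}∂_{x'_i}k. Write s_p(x) = ∂_{x_i} log p(x), s_q(x) = ∂_{x_i} log q(x), and δ(x) = s_p(x) − s_q(x). Assume that all integrals below converge absolutely (so Fubini's theorem applies) and that q satisfies Stein's identity in coordinate i for the test functions x ↦ k(x,x') and x ↦ (∂_{x'_i}k)(x,x') for every fixed x', i.e., ∫ ( s_q(x) f(x) + ∂_{x_i} f(x) ) q(x) dx = 0 for each such f. Then ∬ [ s_p(x) s_p(x') k(x,x') + s_p(x) (∂_{x'_i}k)(x,x') + s_p(x') (∂_{x_i}k)(x,x') + (∂_{x_i}∂_{x'_i}k)(x,x') ] q(x) q(x') dx dx' = ∬ δ(x) k(x,x') δ(x') q(x) q(x') dx dx'. -/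
open MeasureTheory

/-- The `i`-th coordinate partial derivative of `f : ℝ^d → ℝ` at `x`. -/
noncomputable def pdCoord (d : ℕ) (i : Fin d) (f : (Fin d → ℝ) → ℝ)
    (x : Fin d → ℝ) : ℝ :=
  deriv (fun t => f (Function.update x i t)) (x i)

open Filter Topology Set

/-- A product `g * f` with `g` a positive integrable `C¹` function and `g' * f` integrable
can only tend to zero at `+∞`: otherwise `(log g)'` would be integrable near `+∞`, so that `g`
would have a positive limit. -/
theorem eq_zero_of_tendsto_mul_atTop {g f : ℝ → ℝ} {L : ℝ} (hg_pos : ∀ t, 0 < g t)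
    (hg : ContDiff ℝ 1 g) (hg_int : Integrable g)
    (hgf : Integrable (fun t => deriv g t * f t))
    (hL : Tendsto (fun t => g t * f t) atTop (𝓝 L)) : L = 0 := by
  by_contra hne
  have hL0 : 0 < |L| := abs_pos.mpr hne
  have hev : ∀ᶠ t in atTop, |L| / 2 < |g t * f t| :=
    hL.abs.eventually (lt_mem_nhds (by linarith))
  obtain ⟨T, hT⟩ := eventually_atTop.mp hev
  have hcont : Continuous (fun t => deriv g t / g t) :=
    (hg.continuous_deriv le_rfl).div hg.continuous fun t => (hg_pos t).ne'
  have hlog_int : IntegrableOn (fun t => deriv g t / g t) (Ioi T) := by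
    refine Integrable.mono' ((hgf.norm.const_mul (2 / |L|)).integrableOn)
      hcont.aestronglyMeasurable ?_
    refine (ae_restrict_iff' measurableSet_Ioi).mpr (ae_of_all _ fun t ht => ?_)
    have h1 := hT t (le_of_lt ht)
    have hgt := hg_pos t
    rw [abs_mul, abs_of_pos hgt] at h1
    rw [Real.norm_eq_abs, Real.norm_eq_abs, abs_div, abs_mul, abs_of_pos hgt,
      div_le_iff₀ hgt]
    have h2 : 1 ≤ 2 / |L| * (g t * |f t|) := by
      rw [div_mul_eq_mul_div, le_div_iff₀ hL0]
      linarith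
    nlinarith [mul_le_mul_of_nonneg_left h2 (abs_nonneg (deriv g t))]
  have hlog := tendsto_limUnder_of_hasDerivAt_of_integrableOn_Ioi
    (f := fun t => Real.log (g t)) (a := T)
    (fun t _ => ((hg.differentiable one_ne_zero t).hasDerivAt.log (hg_pos t).ne')) hlog_int
  set m := limUnder atTop fun t => Real.log (g t)
  have hg_lim : Tendsto g atTop (𝓝 (Real.exp m)) := by
    refine ((Real.continuous_exp.tendsto m).comp hlog).congr fun t => ?_
    exact Real.exp_log (hg_pos t)
  have hev' : ∀ᶠ t in atTop, Real.exp m / 2 < g t :=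
    hg_lim.eventually (lt_mem_nhds (by linarith [Real.exp_pos m]))
  obtain ⟨S, hS⟩ := eventually_atTop.mp hev'
  have hconst : IntegrableOn (fun _ : ℝ => Real.exp m / 2) (Ioi S) := by
    refine Integrable.mono' hg_int.integrableOn aestronglyMeasurable_const ?_
    refine (ae_restrict_iff' measurableSet_Ioi).mpr (ae_of_all _ fun t ht => ?_)
    rw [Real.norm_of_nonneg (by positivity)]
    exact (hS t (le_of_lt ht)).le
  rw [integrableOn_const_iff] at hconst
  simp [(Real.exp_pos m).ne'] at hconst

/-- Stein's identity on the line follows from integrability of the two terms. -/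
theorem integral_deriv_mul_add_eq_zero {g f : ℝ → ℝ} (hg_pos : ∀ t, 0 < g t)
    (hg : ContDiff ℝ 1 g) (hf : Differentiable ℝ f) (hg_int : Integrable g)
    (hgf : Integrable (fun t => deriv g t * f t))
    (hgf' : Integrable (fun t => g t * deriv f t)) :
    ∫ t, (deriv g t * f t + g t * deriv f t) = 0 := by
  have hder : ∀ t, HasDerivAt (fun s => g s * f s) (deriv g t * f t + g t * deriv f t) t :=
    fun t => (hg.differentiable one_ne_zero t).hasDerivAt.mul (hf t).hasDerivAt
  have hint : Integrable (fun t => deriv g t * f t + g t * deriv f t) := hgf.add hgf'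
  have htop := tendsto_limUnder_of_hasDerivAt_of_integrableOn_Ioi (a := 0)
    (fun t _ => hder t) hint.integrableOn
  have hbot := tendsto_limUnder_of_hasDerivAt_of_integrableOn_Iic (a := 0)
    (fun t _ => hder t) hint.integrableOn
  have htop0 := eq_zero_of_tendsto_mul_atTop hg_pos hg hg_int hgf htop
  have hbot0 := eq_zero_of_tendsto_mul_atTop (g := fun t => g (-t)) (f := fun t => f (-t))
    (fun t => hg_pos _) (hg.comp contDiff_neg) hg_int.comp_neg
    (by simpa [deriv_comp_neg] using hgf.comp_neg.neg) (hbot.comp tendsto_neg_atTop_atBot)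
  rw [integral_of_hasDerivAt_of_tendsto hder hint hbot htop, htop0, hbot0, sub_zero]

theorem pdCoord_insertNth {n : ℕ} (i : Fin (n + 1)) (f : (Fin (n + 1) → ℝ) → ℝ) (t : ℝ)
    (y : Fin n → ℝ) :
    pdCoord (n + 1) i f (i.insertNth t y) = deriv (fun s => f (i.insertNth s y)) t := by
  simp [pdCoord]

/-- Stein's identity in coordinate `i` follows from integrability of the two terms. -/
theorem stein_identity_of_integrable {d : ℕ} (i : Fin d) {q f : (Fin d → ℝ) → ℝ}
    (hq_pos : ∀ x, 0 < q x) (hq : ContDiff ℝ 1 q) (hq_int : Integrable q)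
    (hf : ∀ x : Fin d → ℝ, Differentiable ℝ (fun t => f (Function.update x i t)))
    (h1 : Integrable (fun x => pdCoord d i (fun y => Real.log (q y)) x * f x * q x))
    (h2 : Integrable (fun x => pdCoord d i f x * q x)) :
    ∫ x, (pdCoord d i (fun y => Real.log (q y)) x * f x + pdCoord d i f x) * q x = 0 := by
  obtain _ | n := d
  · exact i.elim0
  have hmp := (volume_preserving_piFinSuccAbove (fun _ : Fin (n + 1) => ℝ) i).symm
  have hemb := (MeasurableEquiv.piFinSuccAbove (fun _ : Fin (n + 1) => ℝ) i).symm.measurableEmbedding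
  have hint : ∀ {F : (Fin (n + 1) → ℝ) → ℝ}, Integrable F →
      Integrable (fun z : ℝ × (Fin n → ℝ) => F (i.insertNth z.1 z.2)) := fun hF =>
    (hmp.integrable_comp_emb hemb).mpr hF
  have hsum : Integrable (fun x => (pdCoord (n + 1) i (fun y => Real.log (q y)) x * f x
      + pdCoord (n + 1) i f x) * q x) := by
    exact (h1.add h2).congr (ae_of_all _ fun x => (add_mul _ _ _).symm)
  rw [← hmp.integral_comp hemb]
  refine (integral_prod_symm _ (hint hsum)).trans (integral_eq_zero_of_ae ?_)
  filter_upwards [(hint hq_int).prod_left_ae, (hint h1).prod_left_ae, (hint h2).prod_left_ae]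
    with y hy hy1 hy2
  have hg : ContDiff ℝ 1 (fun t => q (i.insertNth t y)) := by
    refine hq.comp (contDiff_pi.mpr fun j => ?_)
    refine Fin.succAboveCases i ?_ (fun j => ?_) j
    · simpa using contDiff_fun_id
    · simpa using contDiff_const
  have hlog : ∀ t, pdCoord (n + 1) i (fun y => Real.log (q y)) (i.insertNth t y)
      = deriv (fun s => q (i.insertNth s y)) t / q (i.insertNth t y) := fun t => by
    rw [pdCoord_insertNth]
    exact ((hg.differentiable one_ne_zero t).hasDerivAt.log (hq_pos _).ne').deriv
  have hfy : Differentiable ℝ (fun t => f (i.insertNth t y)) := by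
    simpa using hf (i.insertNth 0 y)
  have hterm : ∀ t, pdCoord (n + 1) i (fun y => Real.log (q y)) (i.insertNth t y)
      * f (i.insertNth t y) * q (i.insertNth t y)
      = deriv (fun s => q (i.insertNth s y)) t * f (i.insertNth t y) := fun t => by
    have := (hq_pos (i.insertNth t y)).ne'
    rw [hlog]
    field_simp
  have hterm' : ∀ t, pdCoord (n + 1) i f (i.insertNth t y) * q (i.insertNth t y)
      = q (i.insertNth t y) * deriv (fun s => f (i.insertNth s y)) t := fun t => by
    rw [pdCoord_insertNth, mul_comm]
  simp only [hterm] at hy1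
  simp only [hterm'] at hy2
  refine Eq.trans (integral_congr_ae (ae_of_all _ fun t => ?_))
    (integral_deriv_mul_add_eq_zero (fun t => hq_pos _) hg hfy hy hy1 hy2)
  change (_ + _) * q (i.insertNth t y) = _
  rw [add_mul]
  exact congrArg₂ (· + ·) (hterm t) (hterm' t)

/-- Identity (4) in Theorem 3.2 of the paper: if `q` satisfies
Stein's identity in coordinate `i` for the kernel sections `k(·,x')` and
`(∂_{x'_i}k)(·,x')`, then the double-Stein kernel expectation
`∬ 𝒮_{p,x_i}𝒮_{p,x'_i}k(x,x') q(x)q(x') dx dx'` equals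
`∬ δ(x) k(x,x') δ(x') q(x)q(x') dx dx'` with `δ = s_p − s_q` the difference of
the coordinate score functions. -/
theorem stmt_3
    (d : ℕ) (i : Fin d)
    (p q : (Fin d → ℝ) → ℝ)
    (hp_pos : ∀ x, 0 < p x) (hq_pos : ∀ x, 0 < q x)
    (hp_smooth : ContDiff ℝ 1 p) (hq_smooth : ContDiff ℝ 1 q)
    (hp_prob : ∫ x, p x = 1) (hq_prob : ∫ x, q x = 1)
    (k : (Fin d → ℝ) → (Fin d → ℝ) → ℝ)
    -- `k` is continuously differentiable in the `i`-th coordinate of each argument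
    (hk1_smooth : ∀ x x' : Fin d → ℝ,
      ContDiff ℝ 1 (fun t => k (Function.update x i t) x'))
    (hk2_smooth : ∀ x x' : Fin d → ℝ,
      ContDiff ℝ 1 (fun t => k x (Function.update x' i t)))
    -- score functions and their difference
    (sp sq δ : (Fin d → ℝ) → ℝ)
    (hsp : ∀ x, sp x = pdCoord d i (fun y => Real.log (p y)) x)
    (hsq : ∀ x, sq x = pdCoord d i (fun y => Real.log (q y)) x)
    (hδ : ∀ x, δ x = sp x - sq x)
    -- kernel partial derivatives in the `i`-th coordinate of each argument
    (k1 k2 k12 : (Fin d → ℝ) → (Fin d → ℝ) → ℝ)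
    (hk1 : ∀ x x', k1 x x' = pdCoord d i (fun y => k y x') x)
    (hk2 : ∀ x x', k2 x x' = pdCoord d i (fun y => k x y) x')
    (hk12 : ∀ x x', k12 x x' = pdCoord d i (fun y => k2 y x') x)
    -- the mixed partial is continuous
    (hmix_cont : Continuous (fun z : (Fin d → ℝ) × (Fin d → ℝ) => k12 z.1 z.2))
    -- Stein's identity for `q` in coordinate `i`, for the test functions
    -- `x ↦ k(x,x')` and `x ↦ (∂_{x'_i}k)(x,x')`, with absolute convergence
    (hstein1_int : ∀ x', Integrable (fun x => (sq x * k x x' + k1 x x') * q x))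
    (hstein1 : ∀ x', ∫ x, (sq x * k x x' + k1 x x') * q x = 0)
    (hstein2_int : ∀ x', Integrable (fun x => (sq x * k2 x x' + k12 x x') * q x))
    (hstein2 : ∀ x', ∫ x, (sq x * k2 x x' + k12 x x') * q x = 0)
    -- all (double) integrals below converge absolutely, so Fubini applies
    (habs1 : Integrable (fun z : (Fin d → ℝ) × (Fin d → ℝ) =>
      sp z.1 * sp z.2 * k z.1 z.2 * (q z.1 * q z.2)))
    (habs2 : Integrable (fun z : (Fin d → ℝ) × (Fin d → ℝ) =>
      sp z.1 * k2 z.1 z.2 * (q z.1 * q z.2)))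
    (habs3 : Integrable (fun z : (Fin d → ℝ) × (Fin d → ℝ) =>
      sp z.2 * k1 z.1 z.2 * (q z.1 * q z.2)))
    (habs4 : Integrable (fun z : (Fin d → ℝ) × (Fin d → ℝ) =>
      k12 z.1 z.2 * (q z.1 * q z.2)))
    (habs5 : Integrable (fun z : (Fin d → ℝ) × (Fin d → ℝ) =>
      δ z.1 * k z.1 z.2 * δ z.2 * (q z.1 * q z.2)))
    (habs6 : Integrable (fun z : (Fin d → ℝ) × (Fin d → ℝ) =>
      sp z.1 * sq z.2 * k z.1 z.2 * (q z.1 * q z.2)))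
    (habs7 : Integrable (fun z : (Fin d → ℝ) × (Fin d → ℝ) =>
      sq z.1 * sp z.2 * k z.1 z.2 * (q z.1 * q z.2)))
    (habs8 : Integrable (fun z : (Fin d → ℝ) × (Fin d → ℝ) =>
      sq z.1 * sq z.2 * k z.1 z.2 * (q z.1 * q z.2)))
    (habs9 : Integrable (fun z : (Fin d → ℝ) × (Fin d → ℝ) =>
      sq z.1 * k2 z.1 z.2 * (q z.1 * q z.2)))
    (habs10 : Integrable (fun z : (Fin d → ℝ) × (Fin d → ℝ) =>
      sq z.2 * k1 z.1 z.2 * (q z.1 * q z.2))) :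
    ∫ z : (Fin d → ℝ) × (Fin d → ℝ),
        (sp z.1 * sp z.2 * k z.1 z.2 + sp z.1 * k2 z.1 z.2
          + sp z.2 * k1 z.1 z.2 + k12 z.1 z.2) * (q z.1 * q z.2)
      = ∫ z : (Fin d → ℝ) × (Fin d → ℝ),
          δ z.1 * k z.1 z.2 * δ z.2 * (q z.1 * q z.2) := by
  have hq_int : Integrable q := by
    by_contra h
    rw [integral_undef h] at hq_prob
    exact zero_ne_one hq_prob
  have hI1 : Integrable (fun z : (Fin d → ℝ) × (Fin d → ℝ) =>
      sp z.2 * q z.2 * ((sq z.1 * k z.1 z.2 + k1 z.1 z.2) * q z.1)) :=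
    (habs7.add habs3).congr (ae_of_all _ fun z => by simp only [Pi.add_apply]; ring)
  have hI2 : Integrable (fun z : (Fin d → ℝ) × (Fin d → ℝ) =>
      q z.2 * ((sq z.1 * k2 z.1 z.2 + k12 z.1 z.2) * q z.1)) :=
    (habs9.add habs4).congr (ae_of_all _ fun z => by simp only [Pi.add_apply]; ring)
  have hJ1 : Integrable (fun z : (Fin d → ℝ) × (Fin d → ℝ) =>
      δ z.1 * q z.1 * (sq z.2 * k z.1 z.2 * q z.2)) :=
    (habs6.sub habs8).congr (ae_of_all _ fun z => by simp only [Pi.sub_apply, hδ]; ring)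
  have hJ2 : Integrable (fun z : (Fin d → ℝ) × (Fin d → ℝ) =>
      δ z.1 * q z.1 * (k2 z.1 z.2 * q z.2)) :=
    (habs2.sub habs9).congr (ae_of_all _ fun z => by simp only [Pi.sub_apply, hδ]; ring)
  have hI3 : Integrable (fun z : (Fin d → ℝ) × (Fin d → ℝ) =>
      δ z.1 * q z.1 * ((sq z.2 * k z.1 z.2 + k2 z.1 z.2) * q z.2)) :=
    (hJ1.add hJ2).congr (ae_of_all _ fun z => by simp only [Pi.add_apply]; ring)
  have hE1 : ∫ z : (Fin d → ℝ) × (Fin d → ℝ),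
      sp z.2 * q z.2 * ((sq z.1 * k z.1 z.2 + k1 z.1 z.2) * q z.1) = 0 := by
    refine (integral_prod_symm _ hI1).trans ?_
    simp only [integral_const_mul, hstein1, mul_zero, integral_zero]
  have hE2 : ∫ z : (Fin d → ℝ) × (Fin d → ℝ),
      q z.2 * ((sq z.1 * k2 z.1 z.2 + k12 z.1 z.2) * q z.1) = 0 := by
    refine (integral_prod_symm _ hI2).trans ?_
    simp only [integral_const_mul, hstein2, mul_zero, integral_zero]
  -- No Stein identity in the second argument is assumed; it follows from integrability.
  have hE3 : ∫ z : (Fin d → ℝ) × (Fin d → ℝ),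
      δ z.1 * q z.1 * ((sq z.2 * k z.1 z.2 + k2 z.1 z.2) * q z.2) = 0 := by
    refine (integral_prod _ hI3).trans (integral_eq_zero_of_ae ?_)
    filter_upwards [hJ1.prod_right_ae, hJ2.prod_right_ae] with x hx1 hx2
    simp only [integral_const_mul, Pi.zero_apply]
    by_cases hδx : δ x = 0
    · simp [hδx]
    have hc : IsUnit (δ x * q x) := (mul_ne_zero hδx (hq_pos x).ne').isUnit
    rw [integrable_const_mul_iff hc] at hx1 hx2
    simp only [hsq, hk2] at hx1 hx2 ⊢
    rw [stein_identity_of_integrable i hq_pos hq_smooth hq_int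
      (fun x' => (hk2_smooth x x').differentiable one_ne_zero) hx1 hx2, mul_zero]
  have hsplit : ∀ z : (Fin d → ℝ) × (Fin d → ℝ),
      (sp z.1 * sp z.2 * k z.1 z.2 + sp z.1 * k2 z.1 z.2
          + sp z.2 * k1 z.1 z.2 + k12 z.1 z.2) * (q z.1 * q z.2)
      = δ z.1 * k z.1 z.2 * δ z.2 * (q z.1 * q z.2)
        + sp z.2 * q z.2 * ((sq z.1 * k z.1 z.2 + k1 z.1 z.2) * q z.1)
        + q z.2 * ((sq z.1 * k2 z.1 z.2 + k12 z.1 z.2) * q z.1)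
        + δ z.1 * q z.1 * ((sq z.2 * k z.1 z.2 + k2 z.1 z.2) * q z.2) := fun z => by
    simp only [hδ]
    ring
  simp only [hsplit]
  rw [integral_add (by exact (habs5.add hI1).add hI2) hI3,
    integral_add (by exact habs5.add hI1) hI2, integral_add habs5 hI1, hE1, hE2, hE3]
  simp only [add_zero]
end

section
/- Let p and q be positive continuously differentiable probability densities on ℝ^d, and for each coordinate i ∈ {1,…,d} set δ_i(x) = ∂_{x_i} log p(x) − ∂_{x_i} log q(x). Suppose each kernel k_i : ℝ^d × ℝ^d → ℝ is strictly integrally positive definite, that ∫ ( q(x) δ_i(x) )² dx < ∞ for every i, and that the double integrals ∬ δ_i(x) k_i(x,x') δ_i(x') q(x) q(x') dx dx' converge absolutely. If Σ_{i=1}^d ∬ δ_i(x) k_i(x,x') δ_i(x') q(x) q(x') dx dx' = 0, then p(x) = q(x) for all x ∈ ℝ^d. -/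
open MeasureTheory

/-- A kernel `k` on a measure space `E` is strictly integrally positive
definite: `∬ g(x) k(x,x') g(x') dx dx' > 0` for every measurable `g` with
`0 < ∫ g² < ∞` for which the double integral converges absolutely. -/
def StrictlyIntegrallyPosDef {E : Type*} [MeasureSpace E] (k : E → E → ℝ) : Prop :=
  ∀ g : E → ℝ, Measurable g →
    Integrable (fun x => g x ^ 2) → 0 < ∫ x, g x ^ 2 →
    Integrable (fun z : E × E => g z.1 * k z.1 z.2 * g z.2) →
    0 < ∫ z : E × E, g z.1 * k z.1 z.2 * g z.2

theorem pdCoord_eq_fderiv {d : ℕ} {f : (Fin d → ℝ) → ℝ} {x : Fin d → ℝ}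
    (hf : DifferentiableAt ℝ f x) (i : Fin d) :
    pdCoord d i f x = fderiv ℝ f x (Pi.single i 1) := by
  have h : HasFDerivAt f (fderiv ℝ f x) (Function.update x i (x i)) := by
    simpa using hf.hasFDerivAt
  exact (h.comp_hasDerivAt (x i) (hasDerivAt_update x i (x i))).deriv

/-- For a continuous `g` with finite `∫ g²`, the energy of a strictly integrally positive definite
kernel is nonnegative, and vanishes only if `g = 0`. -/
theorem StrictlyIntegrallyPosDef.energy_pos_or_eq_zero {d : ℕ}
    {k : (Fin d → ℝ) → (Fin d → ℝ) → ℝ} (hk : StrictlyIntegrallyPosDef k)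
    {g : (Fin d → ℝ) → ℝ} (hg : Continuous g) (hg2 : Integrable (fun x => g x ^ 2))
    (hint : Integrable (fun z : (Fin d → ℝ) × (Fin d → ℝ) => g z.1 * k z.1 z.2 * g z.2)) :
    (0 < ∫ z : (Fin d → ℝ) × (Fin d → ℝ), g z.1 * k z.1 z.2 * g z.2) ∨ g = 0 := by
  have h0 : 0 ≤ fun x => g x ^ 2 := fun x => sq_nonneg (g x)
  rcases (integral_nonneg h0 : 0 ≤ ∫ x, g x ^ 2).lt_or_eq with hpos | hzero
  · exact Or.inl (hk g hg.measurable hg2 hpos hint)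
  · right
    have hae := (integral_eq_zero_iff_of_nonneg h0 hg2).1 hzero.symm
    have heq : (fun x => g x ^ 2) = 0 :=
      Measure.eq_of_ae_eq hae (hg.pow 2) continuous_zero
    funext x
    exact pow_eq_zero_iff two_ne_zero |>.1 (congrFun heq x)

/-- Two positive differentiable probability densities whose log-ratio has zero derivative agree. -/
theorem eq_of_fderiv_log_sub_log_eq_zero {d : ℕ} {p q : (Fin d → ℝ) → ℝ}
    (hp_pos : ∀ x, 0 < p x) (hq_pos : ∀ x, 0 < q x)
    (hdiff : Differentiable ℝ (fun x => Real.log (p x) - Real.log (q x)))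
    (hp_prob : ∫ x, p x = 1) (hq_prob : ∫ x, q x = 1)
    (h : ∀ x, fderiv ℝ (fun x => Real.log (p x) - Real.log (q x)) x = 0) (x : Fin d → ℝ) :
    p x = q x := by
  set c := Real.exp (Real.log (p x) - Real.log (q x)) with hc
  have hpc : ∀ y, p y = c * q y := by
    intro y
    have hy : Real.log (p y) - Real.log (q y) = Real.log (p x) - Real.log (q x) :=
      is_const_of_fderiv_eq_zero hdiff h y x
    rw [hc, ← hy, Real.exp_sub, Real.exp_log (hp_pos y), Real.exp_log (hq_pos y),
      div_mul_cancel₀ _ (hq_pos y).ne']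
  have hc1 : c = 1 := by
    simpa only [hpc, integral_const_mul, hq_prob, mul_one] using hp_prob
  rw [hpc x, hc1, one_mul]

/-- Final claim of Theorem 3.2: if each kernel `k i` is
strictly integrally positive definite, `∫ (q δ_i)² < ∞`, and the δ-form of the
squared Stein discrepancy `∑ i ∬ δ_i(x) k_i(x,x') δ_i(x') q(x)q(x') dx dx'`
vanishes, then `p = q` everywhere. -/
theorem stmt_4
    (d : ℕ)
    (p q : (Fin d → ℝ) → ℝ)
    (hp_pos : ∀ x, 0 < p x) (hq_pos : ∀ x, 0 < q x)
    (hp_smooth : ContDiff ℝ 1 p) (hq_smooth : ContDiff ℝ 1 q)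
    (hp_prob : ∫ x, p x = 1) (hq_prob : ∫ x, q x = 1)
    (δ : Fin d → (Fin d → ℝ) → ℝ)
    (hδ : ∀ i x, δ i x =
      pdCoord d i (fun y => Real.log (p y)) x
        - pdCoord d i (fun y => Real.log (q y)) x)
    (k : Fin d → (Fin d → ℝ) → (Fin d → ℝ) → ℝ)
    (hk : ∀ i, StrictlyIntegrallyPosDef (k i))
    (hL2 : ∀ i, Integrable (fun x => (q x * δ i x) ^ 2))
    (habs : ∀ i, Integrable (fun z : (Fin d → ℝ) × (Fin d → ℝ) =>
      δ i z.1 * k i z.1 z.2 * δ i z.2 * (q z.1 * q z.2)))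
    (hzero : (∑ i, ∫ z : (Fin d → ℝ) × (Fin d → ℝ),
      δ i z.1 * k i z.1 z.2 * δ i z.2 * (q z.1 * q z.2)) = 0) :
    ∀ x, p x = q x := by
  have hlp : ContDiff ℝ 1 (fun x => Real.log (p x)) := hp_smooth.log fun x => (hp_pos x).ne'
  have hlq : ContDiff ℝ 1 (fun x => Real.log (q x)) := hq_smooth.log fun x => (hq_pos x).ne'
  have hdp := hlp.differentiable one_ne_zero
  have hdq := hlq.differentiable one_ne_zero
  have hF := hlp.sub hlq
  have hδF : ∀ i x, δ i x =
      fderiv ℝ (fun x => Real.log (p x) - Real.log (q x)) x (Pi.single i 1) := by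
    intro i x
    rw [hδ, pdCoord_eq_fderiv (hdp x), pdCoord_eq_fderiv (hdq x), fderiv_fun_sub (hdp x) (hdq x)]
    rfl
  have hcont : ∀ i, Continuous (fun x => q x * δ i x) := by
    intro i
    simp only [hδF]
    exact hq_smooth.continuous.mul ((hF.continuous_fderiv one_ne_zero).clm_apply continuous_const)
  have hform : ∀ i, (fun z : (Fin d → ℝ) × (Fin d → ℝ) =>
      δ i z.1 * k i z.1 z.2 * δ i z.2 * (q z.1 * q z.2)) =
      fun z => (q z.1 * δ i z.1) * k i z.1 z.2 * (q z.2 * δ i z.2) := by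
    intro i
    funext z
    ring
  simp only [hform] at habs hzero
  have hor := fun i => (hk i).energy_pos_or_eq_zero (hcont i) (hL2 i) (habs i)
  have hnonneg : ∀ i ∈ Finset.univ, 0 ≤ ∫ z : (Fin d → ℝ) × (Fin d → ℝ),
      (q z.1 * δ i z.1) * k i z.1 z.2 * (q z.2 * δ i z.2) := by
    intro i _
    rcases hor i with h | h
    · exact h.le
    · simp [fun x => show q x * δ i x = 0 from congrFun h x]
  have hδ0 : ∀ i x, δ i x = 0 := by
    intro i x
    have h := (hor i).resolve_left
      ((Finset.sum_eq_zero_iff_of_nonneg hnonneg).1 hzero i (Finset.mem_univ i)).not_gt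
    exact (mul_eq_zero.1 (congrFun h x)).resolve_left (hq_pos x).ne'
  refine eq_of_fderiv_log_sub_log_eq_zero hp_pos hq_pos (hF.differentiable one_ne_zero)
    hp_prob hq_prob fun x => ?_
  refine ContinuousLinearMap.coe_injective (LinearMap.pi_ext' fun i => LinearMap.ext_ring ?_)
  simpa [hδF] using hδ0 i x
end

section
/- Let p and q be positive measurable probability densities on ℝ^d such that for every coordinate i ∈ {1,…,d} and every x ∈ ℝ^d the one-dimensional integrals p_{¬i}(x) = ∫_ℝ p(x_1,…,x_{i−1}, t, x_{i+1},…,x_d) dt and q_{¬i}(x) = ∫_ℝ q(x_1,…,x_{i−1}, t, x_{i+1},…,x_d) dt are finite and positive. If the full conditional densities of p and q agree, i.e., p(x) · q_{¬i}(x) = q(x) · p_{¬i}(x) for every i and every x ∈ ℝ^d, then p(x) = q(x) for almost every x ∈ ℝ^d. -/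
open MeasureTheory

/-- A function on a finite product that is unaffected by updating any one coordinate is
constant. -/
theorem eq_of_forall_update_eq {ι α β : Type*} [Fintype ι] [DecidableEq ι] {f : (ι → α) → β}
    (hf : ∀ (i : ι) (x : ι → α) (t : α), f (Function.update x i t) = f x) (x y : ι → α) :
    f x = f y := by
  have key : ∀ s : Finset ι, f (s.piecewise x y) = f y := by
    intro s
    induction s using Finset.induction_on with
    | empty => simp
    | insert i s _ ih => rw [Finset.piecewise_insert, hf, ih]
  simpa using key Finset.univ

/-- Brook's lemma for positive densities: if two positive
measurable probability densities `p, q` on `ℝ^d` have finite positive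
one-dimensional "complement" integrals
`p_{¬i}(x) = ∫ p(x_1,…,t,…,x_d) dt` and their full conditionals agree, i.e.
`p(x) · q_{¬i}(x) = q(x) · p_{¬i}(x)` for every coordinate `i` and every `x`,
then `p = q` almost everywhere. -/
theorem stmt_6
    (d : ℕ)
    (p q : (Fin d → ℝ) → ℝ)
    (hp_meas : Measurable p) (hq_meas : Measurable q)
    (hp_pos : ∀ x, 0 < p x) (hq_pos : ∀ x, 0 < q x)
    (hp_prob : ∫ x, p x = 1) (hq_prob : ∫ x, q x = 1)
    (hp_int : ∀ (i : Fin d) (x : Fin d → ℝ),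
      Integrable (fun t : ℝ => p (Function.update x i t)))
    (hq_int : ∀ (i : Fin d) (x : Fin d → ℝ),
      Integrable (fun t : ℝ => q (Function.update x i t)))
    (hp_marg_pos : ∀ (i : Fin d) (x : Fin d → ℝ),
      0 < ∫ t : ℝ, p (Function.update x i t))
    (hq_marg_pos : ∀ (i : Fin d) (x : Fin d → ℝ),
      0 < ∫ t : ℝ, q (Function.update x i t))
    (hcond : ∀ (i : Fin d) (x : Fin d → ℝ),
      p x * ∫ t : ℝ, q (Function.update x i t)
        = q x * ∫ t : ℝ, p (Function.update x i t)) :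
    ∀ᵐ x : Fin d → ℝ, p x = q x := by
  have hconst : ∀ x, p x / q x = p 0 / q 0 := by
    refine fun x => eq_of_forall_update_eq (f := fun x => p x / q x) (fun i x t => ?_) x 0
    have h := hcond i (Function.update x i t)
    simp only [Function.update_idem] at h
    have ratio : ∀ z, p z * ∫ t : ℝ, q (Function.update x i t)
        = q z * ∫ t : ℝ, p (Function.update x i t) →
        p z / q z = (∫ t : ℝ, p (Function.update x i t)) / ∫ t : ℝ, q (Function.update x i t) :=
      fun z hz => by
        rw [div_eq_div_iff (hq_pos z).ne' (hq_marg_pos i x).ne', hz, mul_comm]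
    exact (ratio _ h).trans (ratio _ (hcond i x)).symm
  have hmul : ∀ x, p x = p 0 / q 0 * q x := fun x => by
    rw [← hconst x, div_mul_cancel₀ _ (hq_pos x).ne']
  have hone : p 0 / q 0 = 1 := by
    rw [← hp_prob, integral_congr_ae (Filter.Eventually.of_forall hmul), integral_const_mul,
      hq_prob, mul_one]
  exact Filter.Eventually.of_forall fun x => by rw [hmul x, hone, one_mul]
end

section
/- Let p be a positive continuously differentiable probability density on ℝ^d, let C ⊆ {1,…,d} with i ∈ C, and let p_C(x) = ∫ p(x) dx_{¬C} denote the marginal density over the coordinates in C (which depends only on x_C), assumed finite and positive everywhere. Assume differentiation under the integral sign holds: ∂_{x_i} p_C(x) = ∫ ∂_{x_i} p(x) dx_{¬C}. If ∂_{x_i} log p(x) depends only on x_C (i.e., ∂_{x_i} log p(x) = ∂_{x_i} log p(y) whenever x_j = y_j for all j ∈ C), then ∂_{x_i} log p_C(x) = ∂_{x_i} log p(x) for every x ∈ ℝ^d. -/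
open MeasureTheory

/-- Combine the coordinates of `x` on `C` with the coordinates `y` on the
complement of `C`. -/
def mergeOn (d : ℕ) (C : Finset (Fin d)) (x : Fin d → ℝ)
    (y : {j : Fin d // j ∉ C} → ℝ) : Fin d → ℝ :=
  fun j => if h : j ∈ C then x j else y ⟨j, h⟩

/-- If the coordinate score `∂_{x_i} log p` of a positive
`C¹` probability density `p` depends only on the coordinates in `C ∋ i`, and
differentiation under the integral sign holds for the marginal
`p_C(x) = ∫ p dx_{¬C}` (finite and positive), then the score of the marginal
agrees with the score of the joint: `∂_{x_i} log p_C = ∂_{x_i} log p`. -/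
theorem stmt_10
    (d : ℕ) (i : Fin d) (C : Finset (Fin d)) (hiC : i ∈ C)
    (p : (Fin d → ℝ) → ℝ)
    (hp_pos : ∀ x, 0 < p x)
    (hp_smooth : ContDiff ℝ 1 p)
    (hp_prob : ∫ x, p x = 1)
    (pC : (Fin d → ℝ) → ℝ)
    (hpC : ∀ x, pC x = ∫ y : {j : Fin d // j ∉ C} → ℝ, p (mergeOn d C x y))
    (hpC_int : ∀ x, Integrable
      (fun y : {j : Fin d // j ∉ C} → ℝ => p (mergeOn d C x y)))
    (hpC_pos : ∀ x, 0 < pC x)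
    -- differentiation under the integral sign: ∂_{x_i} p_C = ∫ ∂_{x_i} p dx_{¬C}
    (hdui : ∀ x, HasDerivAt (fun t => pC (Function.update x i t))
      (∫ y : {j : Fin d // j ∉ C} → ℝ,
        fderiv ℝ p (mergeOn d C x y) (Pi.single i 1)) (x i))
    -- ∂_{x_i} log p depends only on x_C
    (hloc : ∀ x y : Fin d → ℝ, (∀ j ∈ C, x j = y j) →
      fderiv ℝ (fun z => Real.log (p z)) x (Pi.single i 1)
        = fderiv ℝ (fun z => Real.log (p z)) y (Pi.single i 1)) :
    ∀ x : Fin d → ℝ,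
      deriv (fun t => Real.log (pC (Function.update x i t))) (x i)
        = fderiv ℝ (fun z => Real.log (p z)) x (Pi.single i 1) := by
  intro x
  have hlog : ∀ z, fderiv ℝ p z (Pi.single i 1)
      = fderiv ℝ (fun w => Real.log (p w)) z (Pi.single i 1) * p z := by
    intro z
    have hz := (hp_pos z).ne'
    rw [fderiv.log (hp_smooth.differentiable one_ne_zero z) hz]
    simp only [smul_apply, smul_eq_mul]
    field_simp
  have hint : ∫ y : {j : Fin d // j ∉ C} → ℝ,
      fderiv ℝ p (mergeOn d C x y) (Pi.single i 1)
        = fderiv ℝ (fun w => Real.log (p w)) x (Pi.single i 1) * pC x := by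
    rw [hpC x, ← integral_const_mul]
    refine integral_congr_ae (.of_forall fun y => ?_)
    dsimp only
    rw [hlog, hloc (mergeOn d C x y) x fun j hj => dif_pos hj]
  rw [((hdui x).log (hpC_pos _).ne').deriv, hint, Function.update_eq_self]
  exact mul_div_cancel_right₀ _ (hpC_pos x).ne'
end

section
/- Let p and q be positive continuously differentiable probability densities on ℝ^d, fix a coordinate i and a set C ⊆ {1,…,d} with i ∈ C. Assume: (a) ∂_{x_i} log p(x) depends only on x_C; (b) the marginal q_C(x) = ∫ q(x) dx_{¬C} is finite, positive, and satisfies ∂_{x_i} q_C(x) = ∫ ∂_{x_i} q(x) dx_{¬C}; define δ(x) = ∂_{x_i} log p(x) − ∂_{x_i} log q_C(x) (a function of x_C only). Let κ : ℝ^d × ℝ^d → ℝ be a kernel depending only on (x_C, x'_C), continuously differentiable in the i-th coordinate of each argument with continuous mixed partial ∂_{x_i}∂_{x'_i}κ, and write s_p(x) = ∂_{x_i} log p(x), s_q(x) = ∂_{x_i} log q(x). Assume all integrals below converge absolutely and that q satisfies Stein's identity in coordinate i for the test functions x ↦ κ(x,x') and x ↦ (∂_{x'_i}κ)(x,x') for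 every fixed x'. Then ∬ [ s_p(x) s_p(x') κ(x,x') + s_p(x) (∂_{x'_i}κ)(x,x') + s_p(x') (∂_{x_i}κ)(x,x') + (∂_{x_i}∂_{x'_i}κ)(x,x') ] q(x) q(x') dx dx' = ∬ δ(x) κ(x,x') δ(x') q(x) q(x') dx dx'. -/
open MeasureTheory

section SteinHelpers

open Filter Topology

theorem tendsto_zero_atTop_of_integrable_mul_deriv_log {h h' L s : ℝ → ℝ}
    (hh : ∀ t, HasDerivAt h (h' t) t) (hL : ∀ t, HasDerivAt L (s t) t)
    (hh' : Integrable h') (hs : Integrable fun t => h t * s t)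
    (hexp : Integrable fun t => Real.exp (L t)) : Tendsto h atTop (𝓝 0) := by
  have hlim := tendsto_limUnder_of_hasDerivAt_of_integrableOn_Ioi (a := 0)
    (fun t _ => hh t) hh'.integrableOn
  set m := limUnder atTop h
  rcases eq_or_ne m 0 with hm | hm
  · rwa [hm] at hlim
  exfalso
  have hev : ∀ᶠ t in atTop, |m| / 2 < |h t| :=
    hlim.abs.eventually_const_lt (half_lt_self (abs_pos.2 hm))
  obtain ⟨a, ha⟩ := eventually_atTop.1 hev
  have hs_eq : s = deriv L := funext fun t => (hL t).deriv.symm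
  have hs_int : IntegrableOn s (Set.Ioi a) := by
    refine Integrable.mono' (hs.integrableOn.norm.const_mul (2 / |m|))
      (hs_eq ▸ (measurable_deriv L).aestronglyMeasurable) ?_
    filter_upwards [ae_restrict_mem measurableSet_Ioi] with t ht
    have h1 := ha t (le_of_lt ht)
    have hm' := abs_pos.2 hm
    rw [norm_mul, Real.norm_eq_abs, Real.norm_eq_abs, ← mul_assoc]
    refine le_mul_of_one_le_left (abs_nonneg _) ?_
    rw [div_mul_eq_mul_div, one_le_div hm']
    linarith
  have hLlim := tendsto_limUnder_of_hasDerivAt_of_integrableOn_Ioi (fun t _ => hL t) hs_int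
  have hzero := IntegrableAtFilter.eq_zero_of_tendsto (hexp.integrableAtFilter atTop) (by
    intro S hS
    obtain ⟨b, hb⟩ := mem_atTop_sets.1 hS
    rw [← top_le_iff, ← Real.volume_Ici (a := b)]
    exact measure_mono hb) (Real.continuous_exp.continuousAt.tendsto.comp hLlim)
  exact Real.exp_ne_zero _ hzero

theorem integral_eq_zero_of_integrable_mul_deriv_log {h h' L s : ℝ → ℝ}
    (hh : ∀ t, HasDerivAt h (h' t) t) (hL : ∀ t, HasDerivAt L (s t) t)
    (hh' : Integrable h') (hs : Integrable fun t => h t * s t)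
    (hexp : Integrable fun t => Real.exp (L t)) : ∫ t, h' t = 0 := by
  have htop := tendsto_zero_atTop_of_integrable_mul_deriv_log hh hL hh' hs hexp
  have hneg := tendsto_zero_atTop_of_integrable_mul_deriv_log
    (h := fun t => h (-t)) (h' := fun t => -h' (-t)) (L := fun t => L (-t))
    (s := fun t => -s (-t))
    (fun t => by simpa using! (hh (-t)).scomp t (hasDerivAt_neg t))
    (fun t => by simpa using! (hL (-t)).scomp t (hasDerivAt_neg t))
    hh'.comp_neg.neg (by simpa using! hs.comp_neg.neg) hexp.comp_neg
  have hbot : Tendsto h atBot (𝓝 0) := by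
    simpa [Function.comp_def] using hneg.comp tendsto_neg_atBot_atTop
  simpa using integral_of_hasDerivAt_of_tendsto hh hh' hbot htop

theorem integral_pd_eq_zero_of_integrable_mul_score {d : ℕ} (i : Fin d)
    {h h' p s : (Fin d → ℝ) → ℝ}
    (hh : ∀ x, HasDerivAt (fun t => h (Function.update x i t)) (h' x) (x i))
    (hp : ∀ x, HasDerivAt (fun t => Real.log (p (Function.update x i t))) (s x) (x i))
    (hp_pos : ∀ x, 0 < p x) (hp_int : Integrable p)
    (hh' : Integrable h') (hs : Integrable fun x => h x * s x) : ∫ x, h' x = 0 := by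
  obtain _ | n := d
  · exact i.elim0
  set e := (MeasurableEquiv.piFinSuccAbove (fun _ : Fin (n + 1) => ℝ) i).symm
  have he : MeasurePreserving e := (volume_preserving_piFinSuccAbove (fun _ => ℝ) i).symm _
  have he_apply : ∀ t v, e (t, v) = i.insertNth t v := fun _ _ => rfl
  have hline : ∀ {f f' : (Fin (n + 1) → ℝ) → ℝ},
      (∀ x, HasDerivAt (fun t => f (Function.update x i t)) (f' x) (x i)) →
      ∀ v t, HasDerivAt (fun t => f (e (t, v))) (f' (e (t, v))) t := by
    intro f f' hf v t
    simpa [he_apply] using hf (e (t, v))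
  have hcomp : ∀ {f : (Fin (n + 1) → ℝ) → ℝ}, Integrable f →
      Integrable (fun z => f (e z)) (volume.prod volume) := fun hf =>
    (he.integrable_comp_emb e.measurableEmbedding).2 hf
  rw [← he.integral_comp' (g := h'), Measure.volume_eq_prod, integral_prod_symm _ (hcomp hh')]
  refine integral_eq_zero_of_ae ?_
  filter_upwards [(hcomp hh').prod_left_ae, (hcomp hs).prod_left_ae,
    (hcomp hp_int).prod_left_ae] with v h1 h2 h3
  exact integral_eq_zero_of_integrable_mul_deriv_log (hline hh v)
    (hline (f := fun x => Real.log (p x)) hp v) h1 h2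
    (by simpa only [Real.exp_log (hp_pos _)] using h3)

theorem integral_add_of_integral_eq_zero {X : Type*} [MeasurableSpace X] {μ : Measure X}
    {f g : X → ℝ} (hf : Integrable f μ) (hg : Integrable g μ) (h0 : ∫ x, g x ∂μ = 0) :
    ∫ x, (f x + g x) ∂μ = ∫ x, f x ∂μ := by
  rw [integral_add hf hg, h0, add_zero]

theorem ae_eq_zero_of_integrable_prod_mul {X Y : Type*} [MeasurableSpace X] [MeasurableSpace Y]
    {μ : Measure X} {ν : Measure Y} [SFinite μ] [SFinite ν] {f : X → ℝ} {g : Y → ℝ}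
    (h : Integrable (fun z : X × Y => f z.1 * g z.2) (μ.prod ν)) (hf : ¬ Integrable f μ) :
    g =ᵐ[ν] 0 := by
  filter_upwards [h.prod_left_ae] with y hy
  by_contra hg
  exact hf ((integrable_mul_const_iff (IsUnit.mk0 _ hg) f).1 hy)

theorem integral_sub_mul_integral_sub {Y : Type*} [MeasurableSpace Y]
    {ν : Measure Y} [SFinite ν] {a b Q R : Y → ℝ} {s t : ℝ}
    (hQ : Integrable Q ν) (hR : Integrable R ν) (hQ0 : ∫ y, Q y ∂ν ≠ 0) (hR0 : ∫ y, R y ∂ν ≠ 0)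
    (hsb : Integrable (fun z : Y × Y => s * Q z.1 * b z.2) (ν.prod ν))
    (hat : Integrable (fun z : Y × Y => a z.1 * (t * R z.2)) (ν.prod ν))
    (hab : Integrable (fun z : Y × Y => a z.1 * b z.2) (ν.prod ν)) :
    (∫ y, (s * Q y - a y) ∂ν) * ∫ y, (t * R y - b y) ∂ν
      = (s * ∫ y, Q y ∂ν - ∫ y, a y ∂ν) * (t * ∫ y, R y ∂ν - ∫ y, b y ∂ν) := by
  have key : ∀ {f g P : Y → ℝ} {c : ℝ}, ¬ Integrable f ν → ∫ y, P y ∂ν ≠ 0 →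
      Integrable (fun z : Y × Y => f z.1 * (c * P z.2)) (ν.prod ν) →
      Integrable (fun z : Y × Y => f z.1 * g z.2) (ν.prod ν) →
      c = 0 ∧ g =ᵐ[ν] 0 := by
    intro f g P c hf hP h1 h2
    refine ⟨?_, ae_eq_zero_of_integrable_prod_mul h2 hf⟩
    have h3 := integral_congr_ae
      (ae_eq_zero_of_integrable_prod_mul (g := fun y => c * P y) h1 hf)
    simpa [integral_const_mul, hP] using h3
  have hzero : ∀ {g P : Y → ℝ} {c : ℝ}, c = 0 ∧ g =ᵐ[ν] 0 →
      ∫ y, (c * P y - g y) ∂ν = 0 ∧ c * ∫ y, P y ∂ν - ∫ y, g y ∂ν = 0 := by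
    rintro g P c ⟨rfl, hg⟩
    have hg0 : ∫ y, g y ∂ν = 0 := integral_eq_zero_of_ae hg
    simp [integral_neg, hg0]
  by_cases ha : Integrable a ν
  · by_cases hb : Integrable b ν
    · rw [integral_sub (hQ.const_mul s) ha, integral_sub (hR.const_mul t) hb,
        integral_const_mul, integral_const_mul]
    · obtain ⟨h1, h2⟩ := hzero (P := Q) (key (g := a) hb hQ0
        (by simpa [mul_comm] using! hsb.swap) (by simpa [mul_comm] using! hab.swap))
      rw [h1, h2, zero_mul, zero_mul]
  · obtain ⟨h1, h2⟩ := hzero (P := R) (key (g := b) ha hR0 hat hab)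
    rw [h1, h2, mul_zero, mul_zero]

theorem measurePreserving_prodProdProdComm {X Y Z W : Type*} [MeasureSpace X] [MeasureSpace Y]
    [MeasureSpace Z] [MeasureSpace W] [SFinite (volume : Measure X)]
    [SFinite (volume : Measure Y)] [SFinite (volume : Measure Z)] [SFinite (volume : Measure W)] :
    MeasurePreserving (Equiv.prodProdProdComm X Y Z W) := by
  have h1 : MeasurePreserving (MeasurableEquiv.prodAssoc : (X × Y) × Z × W ≃ᵐ _) :=
    volume_preserving_prodAssoc
  have h2 : MeasurePreserving (MeasurableEquiv.prodAssoc : (Y × Z) × W ≃ᵐ _) :=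
    volume_preserving_prodAssoc
  have h3 : MeasurePreserving (MeasurableEquiv.prodAssoc : (Z × Y) × W ≃ᵐ _) :=
    volume_preserving_prodAssoc
  have h4 : MeasurePreserving (MeasurableEquiv.prodAssoc : (X × Z) × Y × W ≃ᵐ _) :=
    volume_preserving_prodAssoc
  have h5 : MeasurePreserving (Prod.swap : Y × Z → Z × Y) := Measure.measurePreserving_swap
  exact (h4.symm _).comp (((MeasurePreserving.id volume).prod
    (h3.comp ((h5.prod (MeasurePreserving.id volume)).comp (h2.symm _)))).comp h1)

theorem mergeOn_apply_mem {d : ℕ} {C : Finset (Fin d)} (x : Fin d → ℝ)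
    (y : {j : Fin d // j ∉ C} → ℝ) {j : Fin d} (hj : j ∈ C) : mergeOn d C x y j = x j :=
  dif_pos hj

theorem mergeOn_congr {d : ℕ} {C : Finset (Fin d)} {x x' : Fin d → ℝ}
    (h : ∀ j ∈ C, x j = x' j) : mergeOn d C x = mergeOn d C x' := by
  ext y j
  by_cases hj : j ∈ C <;> simp [mergeOn, hj, h]

theorem hasDerivAt_comp_update {d : ℕ} {f : (Fin d → ℝ) → ℝ} {x : Fin d → ℝ} (i : Fin d)
    (hf : DifferentiableAt ℝ f x) :
    HasDerivAt (fun t => f (Function.update x i t)) (fderiv ℝ f x (Pi.single i 1)) (x i) := by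
  have hx : HasFDerivAt f (fderiv ℝ f x) (Function.update x i (x i)) := by
    simpa using hf.hasFDerivAt
  exact hx.comp_hasDerivAt (x i) (hasDerivAt_update x i (x i))

theorem fderiv_log_mul_self {d : ℕ} {f : (Fin d → ℝ) → ℝ} {x v : Fin d → ℝ}
    (hf : DifferentiableAt ℝ f x) (hx : f x ≠ 0) :
    fderiv ℝ (fun z => Real.log (f z)) x v * f x = fderiv ℝ f x v := by
  rw [fderiv.log hf hx, smul_apply, smul_eq_mul]
  field_simp

/-- A score `s` that is a function of `x_C` and a kernel that is a function of `(x_C, x'_C)` only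
see the marginal over `C` of the density `q` and of its derivative `A`. -/
theorem integral_pairing_eq_marginal {d : ℕ} {C : Finset (Fin d)} {q A s δ : (Fin d → ℝ) → ℝ}
    {κ : (Fin d → ℝ) → (Fin d → ℝ) → ℝ}
    (hs_loc : ∀ x y : Fin d → ℝ, (∀ j ∈ C, x j = y j) → s x = s y)
    (hδ_loc : ∀ x y : Fin d → ℝ, (∀ j ∈ C, x j = y j) → δ x = δ y)
    (hκ_loc : ∀ x x' y y' : Fin d → ℝ,
      (∀ j ∈ C, x j = y j) → (∀ j ∈ C, x' j = y' j) → κ x x' = κ y y')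
    (hq : ∀ x, Integrable fun y : {j : Fin d // j ∉ C} → ℝ => q (mergeOn d C x y))
    (hq_ne : ∀ x, ∫ y : {j : Fin d // j ∉ C} → ℝ, q (mergeOn d C x y) ≠ 0)
    (hδ : ∀ x, δ x * ∫ y : {j : Fin d // j ∉ C} → ℝ, q (mergeOn d C x y)
      = s x * (∫ y : {j : Fin d // j ∉ C} → ℝ, q (mergeOn d C x y))
        - ∫ y : {j : Fin d // j ∉ C} → ℝ, A (mergeOn d C x y))
    (hss : Integrable fun z : (Fin d → ℝ) × (Fin d → ℝ) =>
      κ z.1 z.2 * ((s z.1 * q z.1) * (s z.2 * q z.2)))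
    (hsA : Integrable fun z : (Fin d → ℝ) × (Fin d → ℝ) =>
      κ z.1 z.2 * ((s z.1 * q z.1) * A z.2))
    (hAs : Integrable fun z : (Fin d → ℝ) × (Fin d → ℝ) =>
      κ z.1 z.2 * (A z.1 * (s z.2 * q z.2)))
    (hAA : Integrable fun z : (Fin d → ℝ) × (Fin d → ℝ) => κ z.1 z.2 * (A z.1 * A z.2))
    (hδδ : Integrable fun z : (Fin d → ℝ) × (Fin d → ℝ) =>
      κ z.1 z.2 * ((δ z.1 * q z.1) * (δ z.2 * q z.2))) :
    ∫ z : (Fin d → ℝ) × (Fin d → ℝ),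
        κ z.1 z.2 * ((s z.1 * q z.1 - A z.1) * (s z.2 * q z.2 - A z.2))
      = ∫ z : (Fin d → ℝ) × (Fin d → ℝ),
        κ z.1 z.2 * ((δ z.1 * q z.1) * (δ z.2 * q z.2)) := by
  set e := (MeasurableEquiv.piEquivPiSubtypeProd (fun _ : Fin d => ℝ) (· ∈ C)).symm
  have he : MeasurePreserving e := by
    convert (volume_preserving_piEquivPiSubtypeProd (fun _ : Fin d => ℝ) (· ∈ C)).symm _
  have he_merge : ∀ u, ∃ x, ∀ y, e (u, y) = mergeOn d C x y := by
    refine fun u => ⟨e (u, 0), fun y => funext fun j => ?_⟩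
    by_cases hj : j ∈ C
    · have hu : ∀ y, e (u, y) j = u ⟨j, hj⟩ := fun _ => dif_pos hj
      rw [mergeOn_apply_mem _ _ hj, hu, hu]
    · have hy : e (u, y) j = y ⟨j, hj⟩ := dif_neg hj
      rw [hy, mergeOn, dif_neg hj]
  have hT := (he.prod he).comp (measurePreserving_prodProdProdComm (X := Subtype (· ∈ C) → ℝ)
    (Y := Subtype (· ∈ C) → ℝ) (Z := {j : Fin d // j ∉ C} → ℝ) (W := {j : Fin d // j ∉ C} → ℝ))
  have hcomp : ∀ {F : (Fin d → ℝ) × (Fin d → ℝ) → ℝ}, Integrable F →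
      Integrable (fun w : ((Subtype (· ∈ C) → ℝ) × (Subtype (· ∈ C) → ℝ)) ×
        (({j : Fin d // j ∉ C} → ℝ) × ({j : Fin d // j ∉ C} → ℝ)) =>
        F (e (w.1.1, w.2.1), e (w.1.2, w.2.2))) (volume.prod volume) := fun hF =>
    hT.integrable_comp_of_integrable hF
  have hint : ∀ {F : (Fin d → ℝ) × (Fin d → ℝ) → ℝ}, Integrable F →
      ∫ z, F z = ∫ w : (Subtype (· ∈ C) → ℝ) × (Subtype (· ∈ C) → ℝ),
        ∫ y : ({j : Fin d // j ∉ C} → ℝ) × ({j : Fin d // j ∉ C} → ℝ),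
          F (e (w.1, y.1), e (w.2, y.2)) := by
    intro F hF
    rw [← integral_prod _ (hcomp hF)]
    have hmap := hT.map_eq
    rw [← Measure.volume_eq_prod] at hmap
    rw [← hmap, integral_map hT.aemeasurable (hmap.symm ▸ hF.aestronglyMeasurable)]
    rfl
  have hFF : Integrable fun z : (Fin d → ℝ) × (Fin d → ℝ) =>
      κ z.1 z.2 * ((s z.1 * q z.1 - A z.1) * (s z.2 * q z.2 - A z.2)) := by
    refine (((hss.sub hsA).sub hAs).add hAA).congr (Eventually.of_forall fun z => ?_)
    simp only [Pi.add_apply, Pi.sub_apply]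
    ring
  rw [hint hFF, hint hδδ]
  refine integral_congr_ae ?_
  filter_upwards [(hcomp hsA).prod_right_ae, (hcomp hAs).prod_right_ae,
    (hcomp hAA).prod_right_ae] with w hsA' hAs' hAA'
  obtain ⟨u, u'⟩ := w
  obtain ⟨x, hx⟩ := he_merge u
  obtain ⟨x', hx'⟩ := he_merge u'
  simp only [hx, hx'] at hsA' hAs' hAA' ⊢
  have hκ' : ∀ y y', κ (mergeOn d C x y) (mergeOn d C x' y') = κ x x' := fun y y' =>
    hκ_loc _ _ _ _ (fun j hj => mergeOn_apply_mem x y hj) fun j hj => mergeOn_apply_mem x' y' hj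
  have hs' : ∀ x y, s (mergeOn d C x y) = s x := fun x y =>
    hs_loc _ _ fun j hj => mergeOn_apply_mem x y hj
  have hδ' : ∀ x y, δ (mergeOn d C x y) = δ x := fun x y =>
    hδ_loc _ _ fun j hj => mergeOn_apply_mem x y hj
  simp only [hκ', hs', hδ'] at hsA' hAs' hAA' ⊢
  rw [integral_const_mul, integral_const_mul]
  rcases eq_or_ne (κ x x') 0 with hk | hk
  · rw [hk, zero_mul, zero_mul]
  have hunit := IsUnit.mk0 _ hk
  rw [integrable_const_mul_iff hunit] at hsA' hAs' hAA'
  congr 1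
  rw [Measure.volume_eq_prod,
    integral_prod_mul (fun y => s x * q (mergeOn d C x y) - A (mergeOn d C x y))
      fun y => s x' * q (mergeOn d C x' y) - A (mergeOn d C x' y),
    integral_prod_mul (fun y => δ x * q (mergeOn d C x y))
      fun y => δ x' * q (mergeOn d C x' y),
    integral_const_mul, integral_const_mul, hδ, hδ]
  exact integral_sub_mul_integral_sub (hq x) (hq x') (hq_ne x) (hq_ne x') hsA' hAs' hAA'

end SteinHelpers

/-- First claim of Theorem 3.3: for a graphical model `p`
whose coordinate score `s_p = ∂_{x_i} log p` depends only on `x_C` (`i ∈ C`),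
a local kernel `κ` depending only on `(x_C, x'_C)`, and `q` satisfying Stein's
identity in coordinate `i` for the kernel sections, the double-Stein kernel
expectation equals the δ-form with
`δ(x) = ∂_{x_i} log p(x) − ∂_{x_i} log q_C(x)` (a function of `x_C` only),
`q_C` being the marginal of `q` over `C`. -/
theorem stmt_12
    (d : ℕ) (i : Fin d) (C : Finset (Fin d)) (hiC : i ∈ C)
    (p q : (Fin d → ℝ) → ℝ)
    (hp_pos : ∀ x, 0 < p x) (hq_pos : ∀ x, 0 < q x)
    (hp_smooth : ContDiff ℝ 1 p) (hq_smooth : ContDiff ℝ 1 q)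
    (hp_prob : ∫ x, p x = 1) (hq_prob : ∫ x, q x = 1)
    -- score functions of p and q
    (sp sq : (Fin d → ℝ) → ℝ)
    (hsp : ∀ x, sp x = fderiv ℝ (fun z => Real.log (p z)) x (Pi.single i 1))
    (hsq : ∀ x, sq x = fderiv ℝ (fun z => Real.log (q z)) x (Pi.single i 1))
    -- (a) ∂_{x_i} log p depends only on x_C
    (hsp_loc : ∀ x y : Fin d → ℝ, (∀ j ∈ C, x j = y j) → sp x = sp y)
    -- (b) the marginal q_C of q over C is finite, positive, and
    -- differentiation under the integral sign holds
    (qC : (Fin d → ℝ) → ℝ)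
    (hqC : ∀ x, qC x = ∫ y : {j : Fin d // j ∉ C} → ℝ, q (mergeOn d C x y))
    (hqC_int : ∀ x, Integrable
      (fun y : {j : Fin d // j ∉ C} → ℝ => q (mergeOn d C x y)))
    (hqC_pos : ∀ x, 0 < qC x)
    (hdui : ∀ x, HasDerivAt (fun t => qC (Function.update x i t))
      (∫ y : {j : Fin d // j ∉ C} → ℝ,
        fderiv ℝ q (mergeOn d C x y) (Pi.single i 1)) (x i))
    -- δ(x) = ∂_{x_i} log p(x) − ∂_{x_i} log q_C(x), a function of x_C only
    (δ : (Fin d → ℝ) → ℝ)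
    (hδ : ∀ x, δ x = sp x - pdCoord d i (fun z => Real.log (qC z)) x)
    -- the kernel κ depends only on (x_C, x'_C)
    (κ : (Fin d → ℝ) → (Fin d → ℝ) → ℝ)
    (hκ_loc : ∀ x x' y y' : Fin d → ℝ,
      (∀ j ∈ C, x j = y j) → (∀ j ∈ C, x' j = y' j) → κ x x' = κ y y')
    -- κ is continuously differentiable in the i-th coordinate of each argument
    (hκ1_smooth : ∀ x x' : Fin d → ℝ,
      ContDiff ℝ 1 (fun t => κ (Function.update x i t) x'))
    (hκ2_smooth : ∀ x x' : Fin d → ℝ,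
      ContDiff ℝ 1 (fun t => κ x (Function.update x' i t)))
    -- kernel partial derivatives in the i-th coordinate of each argument
    (κ1 κ2 κ12 : (Fin d → ℝ) → (Fin d → ℝ) → ℝ)
    (hκ1 : ∀ x x', κ1 x x' = pdCoord d i (fun y => κ y x') x)
    (hκ2 : ∀ x x', κ2 x x' = pdCoord d i (fun y => κ x y) x')
    (hκ12 : ∀ x x', κ12 x x' = pdCoord d i (fun y => κ2 y x') x)
    -- the mixed partial is continuous
    (hmix_cont : Continuous (fun z : (Fin d → ℝ) × (Fin d → ℝ) => κ12 z.1 z.2))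
    -- Stein's identity for q in coordinate i, for the test functions
    -- x ↦ κ(x,x') and x ↦ (∂_{x'_i}κ)(x,x'), with absolute convergence
    (hstein1_int : ∀ x', Integrable (fun x => (sq x * κ x x' + κ1 x x') * q x))
    (hstein1 : ∀ x', ∫ x, (sq x * κ x x' + κ1 x x') * q x = 0)
    (hstein2_int : ∀ x', Integrable (fun x => (sq x * κ2 x x' + κ12 x x') * q x))
    (hstein2 : ∀ x', ∫ x, (sq x * κ2 x x' + κ12 x x') * q x = 0)
    -- all (double) integrals below converge absolutely, so Fubini applies
    (habs1 : Integrable (fun z : (Fin d → ℝ) × (Fin d → ℝ) =>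
      sp z.1 * sp z.2 * κ z.1 z.2 * (q z.1 * q z.2)))
    (habs2 : Integrable (fun z : (Fin d → ℝ) × (Fin d → ℝ) =>
      sp z.1 * κ2 z.1 z.2 * (q z.1 * q z.2)))
    (habs3 : Integrable (fun z : (Fin d → ℝ) × (Fin d → ℝ) =>
      sp z.2 * κ1 z.1 z.2 * (q z.1 * q z.2)))
    (habs4 : Integrable (fun z : (Fin d → ℝ) × (Fin d → ℝ) =>
      κ12 z.1 z.2 * (q z.1 * q z.2)))
    (habs5 : Integrable (fun z : (Fin d → ℝ) × (Fin d → ℝ) =>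
      δ z.1 * κ z.1 z.2 * δ z.2 * (q z.1 * q z.2)))
    (habs6 : Integrable (fun z : (Fin d → ℝ) × (Fin d → ℝ) =>
      sp z.1 * sq z.2 * κ z.1 z.2 * (q z.1 * q z.2)))
    (habs7 : Integrable (fun z : (Fin d → ℝ) × (Fin d → ℝ) =>
      sq z.1 * sp z.2 * κ z.1 z.2 * (q z.1 * q z.2)))
    (habs8 : Integrable (fun z : (Fin d → ℝ) × (Fin d → ℝ) =>
      sq z.1 * sq z.2 * κ z.1 z.2 * (q z.1 * q z.2)))
    (habs9 : Integrable (fun z : (Fin d → ℝ) × (Fin d → ℝ) =>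
      sq z.1 * κ2 z.1 z.2 * (q z.1 * q z.2)))
    (habs10 : Integrable (fun z : (Fin d → ℝ) × (Fin d → ℝ) =>
      sq z.2 * κ1 z.1 z.2 * (q z.1 * q z.2))) :
    ∫ z : (Fin d → ℝ) × (Fin d → ℝ),
        (sp z.1 * sp z.2 * κ z.1 z.2 + sp z.1 * κ2 z.1 z.2
          + sp z.2 * κ1 z.1 z.2 + κ12 z.1 z.2) * (q z.1 * q z.2)
      = ∫ z : (Fin d → ℝ) × (Fin d → ℝ),
          δ z.1 * κ z.1 z.2 * δ z.2 * (q z.1 * q z.2) := by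
  have hq_diff : Differentiable ℝ q := hq_smooth.differentiable one_ne_zero
  have hp_diff : Differentiable ℝ p := hp_smooth.differentiable one_ne_zero
  set A : (Fin d → ℝ) → ℝ := fun x => fderiv ℝ q x (Pi.single i 1) with hA
  have hsqA : ∀ x, sq x * q x = A x := fun x => by
    rw [hsq, fderiv_log_mul_self (hq_diff x) (hq_pos x).ne']
  have hp_int : Integrable p := .of_integral_ne_zero (by simp [hp_prob])
  have hqC_loc : ∀ x y : Fin d → ℝ, (∀ j ∈ C, x j = y j) → qC x = qC y := fun x y h => by
    rw [hqC, hqC, mergeOn_congr h]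
  have hlogqC : ∀ x, pdCoord d i (fun z => Real.log (qC z)) x
      = (∫ y : {j : Fin d // j ∉ C} → ℝ, A (mergeOn d C x y)) / qC x := fun x => by
    have := ((hdui x).log (by simpa using (hqC_pos x).ne')).deriv
    simpa [pdCoord] using this
  have hδ_loc : ∀ x y : Fin d → ℝ, (∀ j ∈ C, x j = y j) → δ x = δ y := fun x y h => by
    rw [hδ, hδ, hlogqC, hlogqC, hsp_loc x y h, hqC_loc x y h, mergeOn_congr h]
  have hδ_mul : ∀ x, δ x * ∫ y : {j : Fin d // j ∉ C} → ℝ, q (mergeOn d C x y)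
      = sp x * (∫ y : {j : Fin d // j ∉ C} → ℝ, q (mergeOn d C x y))
        - ∫ y : {j : Fin d // j ∉ C} → ℝ, A (mergeOn d C x y) := fun x => by
    rw [hδ, hlogqC, ← hqC, sub_mul, div_mul_cancel₀ _ (hqC_pos x).ne']
  have hmarg := integral_pairing_eq_marginal (q := q) (A := A) (s := sp) (δ := δ) (κ := κ)
    hsp_loc hδ_loc hκ_loc hqC_int (fun x => hqC x ▸ (hqC_pos x).ne') hδ_mul
    (habs1.congr (.of_forall fun z => by ring))
    (habs6.congr (.of_forall fun z => by simp only [← hsqA]; ring))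
    (habs7.congr (.of_forall fun z => by simp only [← hsqA]; ring))
    (habs8.congr (.of_forall fun z => by simp only [← hsqA]; ring))
    (habs5.congr (.of_forall fun z => by ring))
  -- Stein's identity in the first argument, weighted by functions of the second argument
  have hfirst1 : ∫ z : (Fin d → ℝ) × (Fin d → ℝ),
      (sq z.1 * sp z.2 * κ z.1 z.2 * (q z.1 * q z.2) + sp z.2 * κ1 z.1 z.2 * (q z.1 * q z.2))
        = 0 := by
    refine (integral_prod_symm _ (habs7.add habs3)).trans <| integral_eq_zero_of_ae (.of_forall fun x' => ?_)
    calc _ = ∫ x, sp x' * q x' * ((sq x * κ x x' + κ1 x x') * q x) := integral_congr_ae (.of_forall fun x => by dsimp; ring)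
      _ = 0 := by rw [integral_const_mul, hstein1, mul_zero]
  have hfirst2 : ∫ z : (Fin d → ℝ) × (Fin d → ℝ),
      (sq z.1 * κ2 z.1 z.2 * (q z.1 * q z.2) + κ12 z.1 z.2 * (q z.1 * q z.2)) = 0 := by
    refine (integral_prod_symm _ (habs9.add habs4)).trans <| integral_eq_zero_of_ae (.of_forall fun x' => ?_)
    calc _ = ∫ x, q x' * ((sq x * κ2 x x' + κ12 x x') * q x) := integral_congr_ae (.of_forall fun x => by dsimp; ring)
      _ = 0 := by rw [integral_const_mul, hstein2, mul_zero]
  -- Stein's identity in the second argument, which does not need `κ` to be symmetric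
  have hκ2_deriv : ∀ x x',
      HasDerivAt (fun t => κ x (Function.update x' i t)) (κ2 x x') (x' i) := fun x x' => by
    rw [hκ2]
    exact ((hκ2_smooth x x').differentiable one_ne_zero _).hasDerivAt
  have hsecond_int := ((habs2.sub habs9).add (habs6.sub habs8))
  have hsecond : ∫ z : (Fin d → ℝ) × (Fin d → ℝ),
      ((sp z.1 * κ2 z.1 z.2 * (q z.1 * q z.2) - sq z.1 * κ2 z.1 z.2 * (q z.1 * q z.2))
        + (sp z.1 * sq z.2 * κ z.1 z.2 * (q z.1 * q z.2)
          - sq z.1 * sq z.2 * κ z.1 z.2 * (q z.1 * q z.2))) = 0 := by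
    refine (integral_prod _ hsecond_int).trans <| integral_eq_zero_of_ae ?_
    filter_upwards [hsecond_int.prod_right_ae, (habs1.sub habs7).prod_right_ae] with x h1 h2
    refine integral_pd_eq_zero_of_integrable_mul_score i (p := p) (s := sp)
      (h := fun x' => (sp x - sq x) * q x * (κ x x' * q x')) (fun x' => ?_) (fun x' => ?_)
      hp_pos hp_int h1 (h2.congr (.of_forall fun x' => ?_))
    · refine (((hκ2_deriv x x').mul (hasDerivAt_comp_update i (hq_diff x'))).const_mul
        ((sp x - sq x) * q x)).congr_deriv ?_
      simp only [Function.update_eq_self]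
      have h3 := hsqA x'
      simp only [hA] at h3
      simp only [Pi.add_apply, Pi.sub_apply, ← h3]
      ring
    · rw [hsp]
      exact hasDerivAt_comp_update i ((hp_diff x').log (hp_pos x').ne')
    · simp only [Pi.sub_apply]
      ring
  calc _ = ∫ z : (Fin d → ℝ) × (Fin d → ℝ),
        (κ z.1 z.2 * ((sp z.1 * q z.1 - A z.1) * (sp z.2 * q z.2 - A z.2))
          + (sq z.1 * sp z.2 * κ z.1 z.2 * (q z.1 * q z.2)
            + sp z.2 * κ1 z.1 z.2 * (q z.1 * q z.2))
          + (sq z.1 * κ2 z.1 z.2 * (q z.1 * q z.2) + κ12 z.1 z.2 * (q z.1 * q z.2))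
          + ((sp z.1 * κ2 z.1 z.2 * (q z.1 * q z.2) - sq z.1 * κ2 z.1 z.2 * (q z.1 * q z.2))
            + (sp z.1 * sq z.2 * κ z.1 z.2 * (q z.1 * q z.2)
              - sq z.1 * sq z.2 * κ z.1 z.2 * (q z.1 * q z.2)))) := by
        congr with z
        simp only [← hsqA]
        ring
    _ = ∫ z : (Fin d → ℝ) × (Fin d → ℝ),
        κ z.1 z.2 * ((sp z.1 * q z.1 - A z.1) * (sp z.2 * q z.2 - A z.2)) := by
        have hpair : Integrable fun z : (Fin d → ℝ) × (Fin d → ℝ) =>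
            κ z.1 z.2 * ((sp z.1 * q z.1 - A z.1) * (sp z.2 * q z.2 - A z.2)) := by
          refine (((habs1.sub habs6).sub habs7).add habs8).congr (.of_forall fun z => ?_)
          simp only [Pi.add_apply, Pi.sub_apply, ← hsqA]
          ring
        have h73 := habs7.add habs3
        have h94 := habs9.add habs4
        exact (integral_add_of_integral_eq_zero ((hpair.add h73).add h94) hsecond_int hsecond).trans
          ((integral_add_of_integral_eq_zero (hpair.add h73) h94 hfirst2).trans
            (integral_add_of_integral_eq_zero hpair h73 hfirst1))
    _ = _ := by
        rw [hmarg]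
        congr with z
        ring
end
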